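/- (Sturm–Liouville eigenfunction identity for generalized Laguerre functions.) Let λ > 0, k ∈ ℕ with k ≥ 1, s ∈ [k−1, k), ν ≥ s, n ∈ ℕ and x > 0. Define A(x) := (TD₀^{s,λ} 𝓛_n^{(−ν,λ)})(x) = e^{−λx} · (the k-th iterated derivative at x of y ↦ (1/Γ(k−s)) ∫₀^y (y−t)^{k−s−1} t^ν L_n^{(ν)}(2λt) dt), and B(t) := t^{s−ν} A(t). Then x^ν · (TD_∞^{s,λ} B)(x) = x^ν · e^{λx} (−1)^k · (the k-th iterated derivative at x of y ↦ (1/Γ(k−s)) ∫_y^∞ (t−y)^{k−s−1} e^{−λt} B(t) dt) = (2λ)^s · (Γ(n+1+ν)/Γ(n+1+ν−s)) · x^ν e^{−λx} L_n^{(ν)}(2λx); that is, 𝓛_n^{(−ν,λ)} is an eigenfunction of the operator u ↦ x^ν TD_∞^{s,λ}{ x^{s−ν} TD₀^{s,λ} u } with eigenvalue (2λ)^s Γ(n+1+ν)/Γ(n+1+ν−s). -/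

import Mathlib

/-- The generalized Laguerre polynomial
L_n^{(α)}(x) = ∑_{j=0}^n (−1)^j (Γ(n+α+1)/(Γ(j+α+1)Γ(n−j+1))) x^j / j!. -/
noncomputable def lagL (α : ℝ) (n : ℕ) (x : ℝ) : ℝ :=
  ∑ j ∈ Finset.range (n + 1),
    (-1 : ℝ) ^ j *
      (Real.Gamma ((n : ℝ) + α + 1) /
        (Real.Gamma ((j : ℝ) + α + 1) * Real.Gamma (((n - j : ℕ) : ℝ) + 1))) *
      x ^ j / (Nat.factorial j : ℝ)

theorem Real.ringChoose_succ (r : ℝ) (m : ℕ) :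
    ((m : ℝ) + 1) * Ring.choose r (m + 1) = (r - m) * Ring.choose r m := by
  have h (k : ℕ) : (k.factorial : ℝ) * Ring.choose r k = (descPochhammer ℤ k).smeval r := by
    rw [Ring.descPochhammer_eq_factorial_smul_choose, nsmul_eq_mul]
  have h1 := h (m + 1)
  rw [descPochhammer_succ_right, Polynomial.smeval_mul, ← h m, Nat.factorial_succ] at h1
  simp only [Polynomial.smeval_sub, Polynomial.smeval_X, Polynomial.smeval_natCast, pow_one,
    pow_zero, nsmul_eq_mul, mul_one] at h1
  have : (m.factorial : ℝ) ≠ 0 := by positivity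
  apply mul_left_cancel₀ this
  push_cast at h1
  linarith

theorem Real.factorial_mul_ringChoose_eq_Gamma_div (r : ℝ) (m : ℕ) (h : 0 < r - m + 1) :
    m.factorial * Ring.choose r m = Real.Gamma (r + 1) / Real.Gamma (r - m + 1) := by
  induction m with
  | zero =>
    have : Real.Gamma (r + 1) ≠ 0 := (Real.Gamma_pos_of_pos (by simpa using h)).ne'
    simp [div_self this]
  | succ m ih =>
    push_cast at h ⊢
    have h0 : 0 < r - m := by linarith
    have ih := ih (by linarith)
    rw [Real.Gamma_add_one h0.ne'] at ih
    have hG : Real.Gamma (r - m) ≠ 0 := (Real.Gamma_pos_of_pos h0).ne'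
    rw [show r - (m + 1) + 1 = r - m by ring, Nat.factorial_succ]
    rw [eq_div_iff (mul_ne_zero h0.ne' hG)] at ih
    rw [eq_div_iff hG, ← ih]
    push_cast
    linear_combination (m.factorial : ℝ) * Real.Gamma (r - m) * Real.ringChoose_succ r m

theorem Real.Gamma_add_natCast_eq_ringChoose (b : ℝ) (hb : 0 < b) (m : ℕ) :
    (-1) ^ m * Real.Gamma (b + m) = m.factorial * Ring.choose (-b) m * Real.Gamma b := by
  induction m with
  | zero => simp
  | succ m ih =>
    have : b + m ≠ 0 := by positivity
    rw [Nat.cast_succ, ← add_assoc, Real.Gamma_add_one this, Nat.factorial_succ]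
    push_cast
    linear_combination -(b + m) * ih -
      (m.factorial : ℝ) * Real.Gamma b * Real.ringChoose_succ (-b) m

open PowerSeries in
/-- The generating function `(1 + t) ^ r * exp (-x * t)`. -/
noncomputable def lagSeries (r x : ℝ) : PowerSeries ℝ :=
  PowerSeries.binomialSeries ℝ r * rescale (-x) (exp ℝ)

/-- The Laguerre polynomial `L_n^{(r - n)}`, for arbitrary real `r`. -/
noncomputable def lagCoeff (r : ℝ) (n : ℕ) (x : ℝ) : ℝ :=
  PowerSeries.coeff n (lagSeries r x)

theorem coeff_rescale_exp (x : ℝ) (m : ℕ) :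
    PowerSeries.coeff m (PowerSeries.rescale x (PowerSeries.exp ℝ)) = x ^ m / m.factorial := by
  simp [PowerSeries.coeff_rescale, PowerSeries.coeff_exp, div_eq_mul_inv]

theorem lagL_eq_lagCoeff (α : ℝ) (hα : -1 < α) (n : ℕ) (x : ℝ) :
    lagL α n x = lagCoeff (n + α) n x := by
  rw [lagCoeff, lagSeries, mul_comm, PowerSeries.coeff_mul,
    Finset.Nat.sum_antidiagonal_eq_sum_range_succ_mk, lagL]
  refine Finset.sum_congr rfl fun j hj => ?_
  have hjn : j ≤ n := Nat.lt_succ_iff.mp (Finset.mem_range.mp hj)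
  have hc : ((n - j : ℕ) : ℝ) = n - j := Nat.cast_sub hjn
  have hj0 : (0 : ℝ) ≤ j := j.cast_nonneg
  have h := Real.factorial_mul_ringChoose_eq_Gamma_div (n + α) (n - j)
    (by rw [hc]; linarith)
  rw [hc, show (n : ℝ) + α - (n - j) + 1 = j + α + 1 by ring] at h
  rw [coeff_rescale_exp, PowerSeries.binomialSeries_coeff, Real.Gamma_nat_eq_factorial,
    ← div_div, ← h, neg_pow x]
  have : ((n - j).factorial : ℝ) ≠ 0 := by positivity
  simp only [smul_eq_mul]
  field_simp

theorem lagCoeff_add (r : ℝ) (n : ℕ) (x u : ℝ) :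
    lagCoeff r n (u + x) =
      ∑ p ∈ Finset.HasAntidiagonal.antidiagonal n, lagCoeff r p.1 x * ((-u) ^ p.2 / p.2.factorial) := by
  rw [lagCoeff, lagSeries, show -(u + x) = -x + -u by ring,
    ← PowerSeries.exp_mul_exp_eq_exp_add, ← mul_assoc, PowerSeries.coeff_mul]
  simp only [coeff_rescale_exp]
  rfl

theorem lagCoeff_add_left (r b : ℝ) (n : ℕ) (x : ℝ) :
    lagCoeff (r + b) n x =
      ∑ p ∈ Finset.HasAntidiagonal.antidiagonal n, lagCoeff r p.1 x * Ring.choose b p.2 := by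
  rw [lagCoeff, lagSeries, PowerSeries.binomialSeries_add, mul_right_comm, PowerSeries.coeff_mul]
  simp only [PowerSeries.binomialSeries_coeff, smul_eq_mul, mul_one]
  rfl

theorem hasDerivAt_lagCoeff (r : ℝ) (n : ℕ) (x : ℝ) :
    HasDerivAt (lagCoeff r n) (lagCoeff r n x - lagCoeff (r + 1) n x) x := by
  have hE (m : ℕ) : HasDerivAt
      (fun y : ℝ => PowerSeries.coeff m (PowerSeries.rescale (-y) (PowerSeries.exp ℝ)))
      (-PowerSeries.coeff m (PowerSeries.rescale (-x) (PowerSeries.exp ℝ) * PowerSeries.X)) x := by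
    simp only [coeff_rescale_exp]
    cases m with
    | zero => simpa using hasDerivAt_const x (1 : ℝ)
    | succ m =>
      rw [PowerSeries.coeff_succ_mul_X, coeff_rescale_exp]
      convert! (((hasDerivAt_id x).neg).pow (m + 1)).div_const ((m + 1).factorial : ℝ) using 1
      rw [Nat.factorial_succ]
      have : (m.factorial : ℝ) ≠ 0 := by positivity
      have : (m : ℝ) + 1 ≠ 0 := by positivity
      push_cast
      simp only [Pi.neg_apply, id]
      field_simp
  have h : lagCoeff r n x - lagCoeff (r + 1) n x = ∑ p ∈ Finset.HasAntidiagonal.antidiagonal n,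
      PowerSeries.coeff p.1 (PowerSeries.binomialSeries ℝ r) *
      (-PowerSeries.coeff p.2
        (PowerSeries.rescale (-x) (PowerSeries.exp ℝ) * PowerSeries.X)) := by
    simp only [mul_neg, Finset.sum_neg_distrib]
    rw [← PowerSeries.coeff_mul, lagCoeff, lagCoeff, lagSeries, lagSeries,
      PowerSeries.binomialSeries_add]
    have := PowerSeries.binomialSeries_nat (R := ℝ) (A := ℝ) 1
    rw [Nat.cast_one, pow_one] at this
    rw [this, ← map_sub, ← map_neg]
    congr 1
    ring
  rw [h]
  have hf : lagCoeff r n = fun y => ∑ p ∈ Finset.HasAntidiagonal.antidiagonal n,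
      PowerSeries.coeff p.1 (PowerSeries.binomialSeries ℝ r) *
      PowerSeries.coeff p.2 (PowerSeries.rescale (-y) (PowerSeries.exp ℝ)) := by
    funext y
    rw [lagCoeff, lagSeries, PowerSeries.coeff_mul]
  rw [hf]
  exact HasDerivAt.fun_sum fun p _ => (hE p.2).const_mul _

theorem iteratedDeriv_exp_neg_mul_lagCoeff (a r : ℝ) (n k : ℕ) :
    iteratedDeriv k (fun y => Real.exp (-(a * y)) * lagCoeff r n (a * y)) =
      fun y => (-a) ^ k * (Real.exp (-(a * y)) * lagCoeff (r + k) n (a * y)) := by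
  induction k with
  | zero => simp
  | succ k ih =>
    rw [iteratedDeriv_succ, ih]
    funext y
    have h1 : HasDerivAt (fun y => a * y) a y := by simpa using (hasDerivAt_id y).const_mul a
    have h2 := (hasDerivAt_lagCoeff (r + k) n (a * y)).comp y h1
    refine (((h1.neg.exp).mul h2).const_mul ((-a) ^ k)).deriv.trans ?_
    simp only [Function.comp_apply, Pi.neg_apply]
    rw [Nat.cast_succ, ← add_assoc]
    ring

open MeasureTheory Set in
theorem integral_Ioi_rpow_mul_exp_mul_lagCoeff {a b : ℝ} (ha : 0 < a) (hb : 0 < b) (r : ℝ) (n : ℕ)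
    (y : ℝ) :
    ∫ t in Ioi y, (t - y) ^ (b - 1) * (Real.exp (-(a * t)) * lagCoeff r n (a * t)) =
      (1 / a) ^ b * Real.Gamma b * (Real.exp (-(a * y)) * lagCoeff (r - b) n (a * y)) := by
  have hI (m : ℕ) : ∫ u in Ioi (0 : ℝ), u ^ (b + m - 1) * Real.exp (-(a * u)) =
      (1 / a) ^ (b + m) * Real.Gamma (b + m) :=
    Real.integral_rpow_mul_exp_neg_mul_Ioi (by positivity) ha
  have hint (m : ℕ) :
      IntegrableOn (fun u => u ^ (b + m - 1) * Real.exp (-(a * u))) (Ioi (0 : ℝ)) :=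
    .of_integral_ne_zero (by rw [hI]; positivity)
  have hmp := (measurePreserving_add_right volume y).setIntegral_preimage_emb
    (MeasurableEquiv.addRight y).measurableEmbedding
    (fun t => (t - y) ^ (b - 1) * (Real.exp (-(a * t)) * lagCoeff r n (a * t))) (Ioi y)
  rw [← hmp]
  have hpre : (fun u => u + y) ⁻¹' Ioi y = Ioi 0 := by ext u; simp
  rw [hpre]
  have hcongr : ∀ u ∈ Ioi (0 : ℝ), (u + y - y) ^ (b - 1) *
      (Real.exp (-(a * (u + y))) * lagCoeff r n (a * (u + y))) =
      ∑ p ∈ Finset.HasAntidiagonal.antidiagonal n,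
        (Real.exp (-(a * y)) * lagCoeff r p.1 (a * y) * ((-a) ^ p.2 / p.2.factorial)) *
          (u ^ (b + p.2 - 1) * Real.exp (-(a * u))) := by
    intro u hu
    rw [mul_add, lagCoeff_add, add_sub_cancel_right, Finset.mul_sum, Finset.mul_sum]
    refine Finset.sum_congr rfl fun p _ => ?_
    rw [show b + (p.2 : ℝ) - 1 = b - 1 + p.2 by ring, Real.rpow_add hu, Real.rpow_natCast,
      neg_add, Real.exp_add, ← neg_mul, mul_pow]
    ring
  rw [setIntegral_congr_fun measurableSet_Ioi hcongr,
    integral_finsetSum _ fun p _ => (hint p.2).const_mul _, sub_eq_add_neg, lagCoeff_add_left,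
    Finset.mul_sum, Finset.mul_sum]
  refine Finset.sum_congr rfl fun p _ => ?_
  rw [integral_const_mul, hI, Real.rpow_add (by positivity), Real.rpow_natCast, neg_pow a]
  have h := Real.Gamma_add_natCast_eq_ringChoose b hb p.2
  have hf : (p.2.factorial : ℝ) ≠ 0 := by positivity
  rw [show ∀ A B C D E F G H : ℝ, A * B * (C * D / E) * (F * G * H) = A * B * (D * G) / E * F *
    (C * H) by intros; ring, h, ← mul_pow, mul_one_div_cancel ha.ne', one_pow]
  field_simp

theorem integral_rpow_sub_mul_rpow {b μ y : ℝ} (hb : 0 < b) (hμ : 0 ≤ μ) (hy : 0 < y) :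
    ∫ t in (0 : ℝ)..y, (y - t) ^ (b - 1) * t ^ μ =
      Real.Gamma b * Real.Gamma (μ + 1) * (y ^ (μ + b) / Real.Gamma (μ + b + 1)) := by
  have h := Complex.betaIntegral_scaled (μ + 1 : ℝ) b hy
  rw [Complex.betaIntegral_eq_Gamma_mul_div _ _ (by simp; linarith) (by simpa)] at h
  rw [← Complex.ofReal_inj, ← intervalIntegral.integral_ofReal]
  convert! h using 1
  · refine intervalIntegral.integral_congr fun t ht => ?_
    rw [Set.uIcc_of_le hy.le] at ht
    push_cast
    rw [Complex.ofReal_cpow (sub_nonneg.mpr ht.2), Complex.ofReal_cpow ht.1]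
    push_cast
    rw [add_sub_cancel_right, mul_comm]
  · rw [← Complex.ofReal_add, Complex.Gamma_ofReal, Complex.Gamma_ofReal, Complex.Gamma_ofReal,
      show μ + 1 + b = μ + b + 1 by ring]
    push_cast
    rw [Complex.ofReal_cpow hy.le]
    push_cast
    rw [add_sub_cancel_right]
    ring

open MeasureTheory in
theorem intervalIntegrable_rpow_sub_mul_rpow {b μ : ℝ} (hb : 0 < b) (hμ : 0 ≤ μ) (y : ℝ) :
    IntervalIntegrable (fun t => (y - t) ^ (b - 1) * t ^ μ) volume 0 y := by
  have h : IntervalIntegrable (fun t : ℝ => t ^ (b - 1)) volume y 0 :=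
    intervalIntegral.intervalIntegrable_rpow' (by linarith)
  have h := h.comp_sub_left y
  simp only [sub_self, sub_zero] at h
  exact h.mul_continuousOn (Real.continuous_rpow_const hμ).continuousOn

theorem iteratedDeriv_rpow_div_Gamma (k : ℕ) {p : ℝ} (hp : (k : ℝ) - 1 < p) :
    Set.EqOn (iteratedDeriv k fun y : ℝ => y ^ p / Real.Gamma (p + 1))
      (fun y => y ^ (p - k) / Real.Gamma (p - k + 1)) (Set.Ioi 0) := by
  induction k with
  | zero => intro y _; simp
  | succ k ih =>
    intro y hy
    push_cast at hp ⊢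
    have hpk : 0 < p - k := by linarith
    rw [iteratedDeriv_succ, ((ih (by linarith)).eventuallyEq_of_mem (Ioi_mem_nhds hy)).deriv_eq]
    refine ((Real.hasDerivAt_rpow_const (p := p - k) (Or.inl hy.ne')).div_const _).deriv.trans ?_
    rw [Real.Gamma_add_one hpk.ne', show p - (k + 1) + 1 = p - k by ring,
      show p - k - 1 = p - (k + 1) by ring]
    exact mul_div_mul_left _ _ hpk.ne'

theorem iteratedDeriv_integral_rpow_mul_lagL {a b ν : ℝ} {k : ℕ} (hb : 0 < b) (hν : 0 ≤ ν)
    (hk : (k : ℝ) ≤ ν + b) (n : ℕ) :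
    Set.EqOn
      (iteratedDeriv k fun y => (1 / Real.Gamma b) *
        ∫ t in (0 : ℝ)..y, (y - t) ^ (b - 1) * (t ^ ν * lagL ν n (a * t)))
      (fun z => Real.Gamma (n + 1 + ν) / Real.Gamma (n + 1 + (ν + b - k)) *
        (z ^ (ν + b - k) * lagL (ν + b - k) n (a * z))) (Set.Ioi 0) := by
  set c : ℕ → ℝ := fun j => (-1) ^ j * (Real.Gamma (n + ν + 1) /
    (Real.Gamma (j + ν + 1) * Real.Gamma ((n - j : ℕ) + 1))) * a ^ j / j.factorial with hc
  have hF : Set.EqOn (fun y => (1 / Real.Gamma b) *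
        ∫ t in (0 : ℝ)..y, (y - t) ^ (b - 1) * (t ^ ν * lagL ν n (a * t)))
      (fun y => ∑ j ∈ Finset.range (n + 1), c j * Real.Gamma (ν + j + 1) *
        (y ^ (ν + j + b) / Real.Gamma (ν + j + b + 1))) (Set.Ioi 0) := by
    intro y hy
    have hy : 0 < y := hy
    have hcongr : Set.EqOn (fun t => (y - t) ^ (b - 1) * (t ^ ν * lagL ν n (a * t)))
        (fun t => ∑ j ∈ Finset.range (n + 1), c j * ((y - t) ^ (b - 1) * t ^ (ν + j)))
        (Set.uIcc 0 y) := by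
      intro t ht
      rw [Set.uIcc_of_le hy.le] at ht
      simp only [lagL, Finset.mul_sum]
      refine Finset.sum_congr rfl fun j _ => ?_
      rw [Real.rpow_add_of_nonneg ht.1 hν (by positivity), Real.rpow_natCast, mul_pow]
      ring
    simp only
    rw [intervalIntegral.integral_congr hcongr, intervalIntegral.integral_finsetSum
      fun j _ => (intervalIntegrable_rpow_sub_mul_rpow hb (by positivity) y).const_mul _,
      Finset.mul_sum]
    refine Finset.sum_congr rfl fun j _ => ?_
    rw [intervalIntegral.integral_const_mul, integral_rpow_sub_mul_rpow hb (by positivity) hy]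
    have := (Real.Gamma_pos_of_pos hb).ne'
    field_simp
  intro z hz
  have hz : 0 < z := hz
  beta_reduce
  rw [hF.iteratedDeriv_of_isOpen isOpen_Ioi k hz]
  have hcd (p : ℝ) : ContDiffAt ℝ k (fun y : ℝ => y ^ p / Real.Gamma (p + 1)) z :=
    (Real.contDiffAt_rpow_const_of_ne hz.ne').div_const _
  rw [iteratedDeriv_fun_sum fun (j : ℕ) _ => contDiffAt_const.mul (hcd (ν + j + b)), lagL,
    Finset.mul_sum, Finset.mul_sum]
  refine Finset.sum_congr rfl fun j _ => ?_
  have hj0 : (0 : ℝ) ≤ j := j.cast_nonneg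
  have hn0 : (0 : ℝ) ≤ n := n.cast_nonneg
  rw [iteratedDeriv_const_mul_field,
    iteratedDeriv_rpow_div_Gamma k (p := ν + j + b) (by linarith) hz]
  simp only [hc]
  have h1 : Real.Gamma (j + ν + 1) ≠ 0 := (Real.Gamma_pos_of_pos (by positivity)).ne'
  have h2 : Real.Gamma (n + (ν + b - k) + 1) ≠ 0 :=
    (Real.Gamma_pos_of_pos (by linarith)).ne'
  have h3 : Real.Gamma (j + (ν + b - k) + 1) ≠ 0 :=
    (Real.Gamma_pos_of_pos (by linarith)).ne'
  have h4 : Real.Gamma ((n - j : ℕ) + 1) ≠ 0 :=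
    (Real.Gamma_pos_of_pos (by positivity)).ne'
  rw [show ν + j + b - k = (ν + b - k) + j by ring, Real.rpow_add hz, Real.rpow_natCast,
    show ν + j + 1 = j + ν + 1 by ring, show ν + b - k + j + 1 = j + (ν + b - k) + 1 by ring,
    show n + 1 + ν = n + ν + 1 by ring,
    show n + 1 + (ν + b - k) = n + (ν + b - k) + 1 by ring, mul_pow]
  field_simp

/-- Sturm–Liouville identity: for λ > 0, k ≥ 1, s ∈ [k−1,k), ν ≥ s,
n ∈ ℕ and x > 0, with A = TD₀^{s,λ} 𝓛_n^{(−ν,λ)} and B(t) = t^{s−ν} A(t),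
x^ν (TD_∞^{s,λ} B)(x) = (2λ)^s (Γ(n+1+ν)/Γ(n+1+ν−s)) x^ν e^{−λx} L_n^{(ν)}(2λx);
i.e. 𝓛_n^{(−ν,λ)} is an eigenfunction of u ↦ x^ν TD_∞^{s,λ}{x^{s−ν} TD₀^{s,λ} u}
with eigenvalue (2λ)^s Γ(n+1+ν)/Γ(n+1+ν−s). -/
theorem sturmLiouville_GLF (lam : ℝ) (hlam : 0 < lam) (k : ℕ) (hk : 1 ≤ k) (s : ℝ)
    (hs1 : (k : ℝ) - 1 ≤ s) (hs2 : s < k) (ν : ℝ) (hν : s ≤ ν) (n : ℕ)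
    (x : ℝ) (hx : 0 < x) :
    let A : ℝ → ℝ := fun z =>
      Real.exp (-(lam * z)) *
        iteratedDeriv k
          (fun y => (1 / Real.Gamma ((k : ℝ) - s)) *
            ∫ t in (0 : ℝ)..y, (y - t) ^ ((k : ℝ) - s - 1) * (t ^ ν * lagL ν n (2 * lam * t))) z
    let B : ℝ → ℝ := fun t => t ^ (s - ν) * A t
    x ^ ν *
        (Real.exp (lam * x) * (-1 : ℝ) ^ k *
          iteratedDeriv k
            (fun y => (1 / Real.Gamma ((k : ℝ) - s)) *
              ∫ t in Set.Ioi y,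
                (t - y) ^ ((k : ℝ) - s - 1) * (Real.exp (-(lam * t)) * B t)) x)
      = (2 * lam) ^ s * (Real.Gamma ((n : ℝ) + 1 + ν) / Real.Gamma ((n : ℝ) + 1 + ν - s)) *
          (x ^ ν * Real.exp (-(lam * x)) * lagL ν n (2 * lam * x)) := by
  intro A B
  have hb : 0 < (k : ℝ) - s := sub_pos.mpr hs2
  have hk1 : (1 : ℝ) ≤ k := by exact_mod_cast hk
  have hν0 : 0 ≤ ν := by linarith
  have ha : 0 < 2 * lam := by positivity
  set C : ℝ := Real.Gamma (n + 1 + ν) / Real.Gamma (n + 1 + ν - s) with hC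
  have hB : ∀ t ∈ Set.Ioi (0 : ℝ), Real.exp (-(lam * t)) * B t =
      C * (Real.exp (-(2 * lam * t)) * lagCoeff (n + (ν - s)) n (2 * lam * t)) := by
    intro t ht
    have ht : 0 < t := ht
    have h := iteratedDeriv_integral_rpow_mul_lagL (a := 2 * lam) hb hν0
      (show (k : ℝ) ≤ ν + (k - s) by linarith) n ht
    simp only [B, A]
    rw [h]
    simp only [show ν + ((k : ℝ) - s) - k = ν - s by ring]
    rw [lagL_eq_lagCoeff _ (by linarith), ← add_sub_assoc, ← hC,
      show -(2 * lam * t) = -(lam * t) + -(lam * t) by ring, Real.exp_add]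
    have h1 : t ^ (s - ν) * t ^ (ν - s) = 1 := by
      rw [← Real.rpow_add ht, show s - ν + (ν - s) = 0 by ring, Real.rpow_zero]
    linear_combination (Real.exp (-(lam * t)) * Real.exp (-(lam * t)) * C *
      lagCoeff (n + (ν - s)) n (2 * lam * t)) * h1
  have hG : Set.EqOn (fun y => (1 / Real.Gamma ((k : ℝ) - s)) *
        ∫ t in Set.Ioi y, (t - y) ^ ((k : ℝ) - s - 1) * (Real.exp (-(lam * t)) * B t))
      (fun y => (C * (1 / (2 * lam)) ^ ((k : ℝ) - s)) * (Real.exp (-(2 * lam * y)) *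
        lagCoeff (n + ν - k) n (2 * lam * y))) (Set.Ioi 0) := by
    intro y hy
    have hcongr : Set.EqOn
        (fun t => (t - y) ^ ((k : ℝ) - s - 1) * (Real.exp (-(lam * t)) * B t))
        (fun t => C * ((t - y) ^ ((k : ℝ) - s - 1) * (Real.exp (-(2 * lam * t)) *
          lagCoeff (n + (ν - s)) n (2 * lam * t)))) (Set.Ioi y) := by
      intro t ht
      simp only [hB t (Set.mem_Ioi.mpr (lt_trans (Set.mem_Ioi.mp hy) ht))]
      ring
    simp only
    rw [MeasureTheory.setIntegral_congr_fun measurableSet_Ioi hcongr,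
      MeasureTheory.integral_const_mul, integral_Ioi_rpow_mul_exp_mul_lagCoeff ha hb,
      show (n : ℝ) + (ν - s) - (k - s) = n + ν - k by ring]
    have := (Real.Gamma_pos_of_pos hb).ne'
    field_simp
  rw [hG.iteratedDeriv_of_isOpen isOpen_Ioi k hx, iteratedDeriv_const_mul_field,
    iteratedDeriv_exp_neg_mul_lagCoeff, sub_add_cancel, lagL_eq_lagCoeff _ (by linarith)]
  have hpow : (1 / (2 * lam)) ^ ((k : ℝ) - s) * (2 * lam) ^ k = (2 * lam) ^ s := by
    rw [one_div, Real.inv_rpow ha.le, ← Real.rpow_neg ha.le, ← Real.rpow_natCast,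
      ← Real.rpow_add ha]
    congr 1
    ring
  have hsign : (-1 : ℝ) ^ k * (-(2 * lam)) ^ k = (2 * lam) ^ k := by
    rw [← mul_pow]
    congr 1
    ring
  have hexp : Real.exp (lam * x) * Real.exp (-(2 * lam * x)) = Real.exp (-(lam * x)) := by
    rw [← Real.exp_add]
    congr 1
    ring
  rw [← hpow, ← hexp, ← hsign]
  ring
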